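/- Let n ≥ 1 be an integer and let α satisfy 0 < α < 1/2. Let u_0,…,u_n be the mid-p upper endpoints at level 1−α, and let v_0,…,v_n be any sequence with 0 ≤ v_0 ≤ v_1 ≤ ⋯ ≤ v_n = 1, with coverages C_u and C_v defined by C_w(p) = Σ_{x=i}^n B(n,x,p) for the smallest index i with p ≤ w_i. Then ∫_0^1 (C_u(p) − (1−α))² dp ≤ ∫_0^1 (C_v(p) − (1−α))² dp and ∫_0^1 |C_u(p) − (1−α)| dp ≤ ∫_0^1 |C_v(p) − (1−α)| dp; that is, the mid-p method minimises both the mean-square error and the mean absolute error of coverage over p uniform on (0,1). -/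

import Mathlib

open MeasureTheory

/-- The binomial probability mass function: `B n x p = C(n,x) p^x (1-p)^(n-x)`. -/
noncomputable def B (n x : ℕ) (p : ℝ) : ℝ :=
  (n.choose x : ℝ) * p ^ x * (1 - p) ^ (n - x)

/-- A sequence `0 < u 0 < u 1 < ⋯ < u n = 1` of OLC upper endpoints at level `1 - α`:
each inter-spike average coverage equals the nominal level. -/
def IsOLCUpper (n : ℕ) (α : ℝ) (u : ℕ → ℝ) : Prop :=
  0 < u 0 ∧ (∀ i, i < n → u i < u (i + 1)) ∧ u n = 1 ∧
    ∀ i, 1 ≤ i → i ≤ n →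
      (∫ p in (u (i - 1))..(u i), ∑ x ∈ Finset.Icc i n, B n x p)
        = (1 - α) * (u i - u (i - 1))

/-- A sequence `0 < v 0 < v 1 < ⋯ < v n = 1` giving upper-tail locally correct confidence
(LCC) intervals at level `1 - α`: each inter-spike average coverage is at least the
nominal level. -/
def IsLCCUpper (n : ℕ) (α : ℝ) (v : ℕ → ℝ) : Prop :=
  0 < v 0 ∧ (∀ i, i < n → v i < v (i + 1)) ∧ v n = 1 ∧
    ∀ i, 1 ≤ i → i ≤ n →
      (1 - α) * (v i - v (i - 1))
        ≤ ∫ p in (v (i - 1))..(v i), ∑ x ∈ Finset.Icc i n, B n x p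

/-- A sequence `0 = l 0 < l 1 < ⋯ < l n < 1` of OLC lower endpoints at level `1 - α`. -/
def IsOLCLower (n : ℕ) (α : ℝ) (l : ℕ → ℝ) : Prop :=
  l 0 = 0 ∧ (∀ i, i < n → l i < l (i + 1)) ∧ l n < 1 ∧
    ∀ i, i < n →
      (∫ p in (l i)..(l (i + 1)), ∑ x ∈ Finset.range (i + 1), B n x p)
        = (1 - α) * (l (i + 1) - l i)

/-- A sequence `0 = l 0 < l 1 < ⋯ < l n < 1` giving lower-tail LCC intervals at level
`1 - α`. -/
def IsLCCLower (n : ℕ) (α : ℝ) (l : ℕ → ℝ) : Prop :=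
  l 0 = 0 ∧ (∀ i, i < n → l i < l (i + 1)) ∧ l n < 1 ∧
    ∀ i, i < n →
      (1 - α) * (l (i + 1) - l i)
        ≤ ∫ p in (l i)..(l (i + 1)), ∑ x ∈ Finset.range (i + 1), B n x p

/-- Mid-p upper endpoints at level `1 - α`: `u n = 1` and, for `i < n`,
`u i ∈ (0,1)` solves `P(X < i) + (1/2) P(X = i) = α` at `p = u i`. -/
def IsMidPUpper (n : ℕ) (α : ℝ) (u : ℕ → ℝ) : Prop :=
  u n = 1 ∧ ∀ i, i < n → 0 < u i ∧ u i < 1 ∧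
    (∑ x ∈ Finset.range i, B n x (u i)) + (1 / 2) * B n i (u i) = α

/-- Mid-p lower endpoints at level `1 - α`: `l 0 = 0` and, for `1 ≤ i ≤ n`,
`l i ∈ (0,1)` solves `P(X > i) + (1/2) P(X = i) = α` at `p = l i`. -/
def IsMidPLower (n : ℕ) (α : ℝ) (l : ℕ → ℝ) : Prop :=
  l 0 = 0 ∧ ∀ i, 1 ≤ i → i ≤ n → 0 < l i ∧ l i < 1 ∧
    (∑ x ∈ Finset.Icc (i + 1) n, B n x (l i)) + (1 / 2) * B n i (l i) = α

/-- The coverage of an upper-tail endpoint sequence `w` at `p`: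
`∑_{x=i}^n B(n,x,p)` where `i` is the smallest index with `p ≤ w i`. -/
noncomputable def cov (n : ℕ) (w : ℕ → ℝ) (p : ℝ) : ℝ :=
  ∑ x ∈ Finset.Icc (sInf {i : ℕ | p ≤ w i}) n, B n x p

theorem B_eq_eval (n x : ℕ) (p : ℝ) : B n x p = (bernsteinPolynomial ℝ n x).eval p := by
  simp [B, bernsteinPolynomial]

theorem B_nonneg (n x : ℕ) {p : ℝ} (h0 : 0 ≤ p) (h1 : p ≤ 1) : 0 ≤ B n x p := by
  have : 0 ≤ 1 - p := by linarith
  unfold B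
  positivity

theorem continuous_B (n x : ℕ) : Continuous (B n x) := by
  unfold B
  fun_prop

theorem sum_range_B (n : ℕ) (p : ℝ) : ∑ x ∈ Finset.range (n + 1), B n x p = 1 := by
  have h := congrArg (Polynomial.eval p) (bernsteinPolynomial.sum ℝ n)
  rw [Polynomial.eval_finsetSum] at h
  simpa [B_eq_eval] using h

/-- The lower and upper binomial tails are complementary. -/
theorem sum_Icc_B (n i : ℕ) (hi : i ≤ n) (p : ℝ) :
    ∑ x ∈ Finset.Icc i n, B n x p = 1 - ∑ x ∈ Finset.range i, B n x p := by
  have h := Finset.sum_range_add_sum_Ico (fun x => B n x p) (show i ≤ n + 1 by omega)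
  rw [sum_range_B] at h
  have hI : Finset.Icc i n = Finset.Ico i (n + 1) := by
    ext x
    simp
  rw [hI]
  linarith

open Polynomial in
theorem derivative_sum_range_bernstein (n k : ℕ) :
    derivative (∑ x ∈ Finset.range (k + 1), bernsteinPolynomial ℝ n x)
      = -(n : ℝ[X]) * bernsteinPolynomial ℝ (n - 1) k := by
  induction k with
  | zero => simp [bernsteinPolynomial.derivative_zero]
  | succ k ih =>
    rw [Finset.sum_range_succ, derivative_add, ih, bernsteinPolynomial.derivative_succ]
    ring

/-- The binomial distribution function is nonincreasing in the success probability. -/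
theorem antitoneOn_sum_range_B (n k : ℕ) :
    AntitoneOn (fun p => ∑ x ∈ Finset.range k, B n x p) (Set.Icc 0 1) := by
  cases k with
  | zero => simpa using antitoneOn_const
  | succ k =>
    have hfun : (fun p => ∑ x ∈ Finset.range (k + 1), B n x p)
        = fun p => (∑ x ∈ Finset.range (k + 1), bernsteinPolynomial ℝ n x).eval p := by
      funext p
      simp [B_eq_eval, Polynomial.eval_finsetSum]
    rw [hfun]
    refine antitoneOn_of_deriv_nonpos (convex_Icc 0 1) (Polynomial.continuousOn _)
      (Polynomial.differentiableOn _) fun p hp => ?_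
    rw [interior_Icc] at hp
    rw [Polynomial.deriv, derivative_sum_range_bernstein, Polynomial.eval_mul, ← B_eq_eval]
    have := B_nonneg (n - 1) k hp.1.le hp.2.le
    simp only [Polynomial.eval_neg, Polynomial.eval_natCast, neg_mul, Left.neg_nonpos_iff]
    positivity

theorem measurable_sInf_endpoint_index (w : ℕ → ℝ) :
    Measurable fun p : ℝ => sInf {i : ℕ | p ≤ w i} := by
  refine measurable_to_countable' fun k => ?_
  have hset : (fun p : ℝ => sInf {i : ℕ | p ≤ w i}) ⁻¹' {k}
      = {p | (p ≤ w k ∧ ∀ j, j < k → ¬ p ≤ w j) ∨ (k = 0 ∧ ∀ j, ¬ p ≤ w j)} := by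
    ext p
    simp only [Set.mem_preimage, Set.mem_singleton_iff, Set.mem_ofPred_eq]
    constructor
    · rintro rfl
      by_cases h : {i : ℕ | p ≤ w i}.Nonempty
      · exact Or.inl ⟨Nat.sInf_mem h, fun j hj => Nat.notMem_of_lt_sInf hj⟩
      · rw [Set.not_nonempty_iff_eq_empty] at h
        refine Or.inr ⟨by simp [h], fun j hj => ?_⟩
        have : j ∈ {i : ℕ | p ≤ w i} := hj
        simp [h] at this
    · rintro (⟨h, hmin⟩ | ⟨rfl, h⟩)
      · refine le_antisymm (Nat.sInf_le h) (not_lt.1 fun hlt => hmin _ hlt ?_)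
        exact Nat.sInf_mem (s := {i : ℕ | p ≤ w i}) ⟨k, h⟩
      · simp [h]
  rw [hset]
  have hp : ∀ i, Measurable fun p : ℝ => p ≤ w i := fun i =>
    measurableSet_setOfPred.1 measurableSet_Iic
  exact measurableSet_setOfPred.2 (((hp k).and (Measurable.forall fun j =>
    Measurable.forall fun _ => (hp j).not)).or
      (measurable_const.and (Measurable.forall fun j => (hp j).not)))

theorem measurable_cov (n : ℕ) (w : ℕ → ℝ) : Measurable (cov n w) := by
  have h : Measurable fun q : ℕ × ℝ => ∑ x ∈ Finset.Icc q.1 n, B n x q.2 :=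
    measurable_from_prod_countable_right fun k =>
      (continuous_finsetSum (Finset.Icc k n) fun x _ => continuous_B n x).measurable
  exact h.comp ((measurable_sInf_endpoint_index w).prodMk measurable_id)

theorem cov_mem_Icc (n : ℕ) (w : ℕ → ℝ) {p : ℝ} (h0 : 0 ≤ p) (h1 : p ≤ 1) :
    cov n w p ∈ Set.Icc (0 : ℝ) 1 := by
  refine ⟨Finset.sum_nonneg fun x _ => B_nonneg n x h0 h1, ?_⟩
  rw [← sum_range_B n p]
  refine Finset.sum_le_sum_of_subset_of_nonneg (fun x hx => ?_) fun x _ _ => B_nonneg n x h0 h1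
  simp only [Finset.mem_Icc, Finset.mem_range] at *
  omega

/-- Any continuous loss of the coverage is integrable over `[0, 1]`. -/
theorem intervalIntegrable_comp_cov (n : ℕ) (w : ℕ → ℝ) {f : ℝ → ℝ} (hf : Continuous f) :
    IntervalIntegrable (fun p => f (cov n w p)) volume 0 1 := by
  obtain ⟨C, hC⟩ := (isCompact_Icc (a := (0 : ℝ)) (b := 1)).exists_bound_of_continuousOn
    hf.continuousOn
  rw [intervalIntegrable_iff_integrableOn_Ioc_of_le zero_le_one]
  refine Measure.integrableOn_of_bounded (M := C) (by simp)
    (hf.measurable.comp (measurable_cov n w)).aestronglyMeasurable ?_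
  filter_upwards [ae_restrict_mem measurableSet_Ioc] with p hp
  exact hC _ (cov_mem_Icc n w hp.1.le hp.2)

/-- At every `p`, the mid-p coverage is at least as close to the nominal level as the coverage
of any other endpoint sequence ending at `1`. -/
theorem abs_cov_midP_sub_le {n : ℕ} {α : ℝ} {u v : ℕ → ℝ} (hu : IsMidPUpper n α u)
    (hvn : v n = 1) {p : ℝ} (h0 : 0 ≤ p) (h1 : p ≤ 1) :
    |cov n u p - (1 - α)| ≤ |cov n v p - (1 - α)| := by
  obtain ⟨hun, hu⟩ := hu
  have hmem : p ≤ u (sInf {i : ℕ | p ≤ u i}) :=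
    Nat.sInf_mem (s := {i : ℕ | p ≤ u i}) ⟨n, by simpa [hun] using h1⟩
  have hin : sInf {i : ℕ | p ≤ u i} ≤ n := Nat.sInf_le (by simpa [hun] using h1)
  have hjn : sInf {i : ℕ | p ≤ v i} ≤ n := Nat.sInf_le (by simpa [hvn] using h1)
  have hmin : ∀ k, k < sInf {i : ℕ | p ≤ u i} → ¬ p ≤ u k := fun k hk => Nat.notMem_of_lt_sInf hk
  unfold cov
  generalize sInf {i : ℕ | p ≤ u i} = i at *
  generalize sInf {i : ℕ | p ≤ v i} = j at *
  rw [sum_Icc_B n i hin, sum_Icc_B n j hjn]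
  have hS : Monotone fun k => ∑ x ∈ Finset.range k, B n x p :=
    monotone_nat_of_le_succ fun k => by
      rw [Finset.sum_range_succ]
      linarith [B_nonneg n k h0 h1]
  have hmid : ∀ k, k < n → (∑ x ∈ Finset.range k, B n x (u k))
      + ∑ x ∈ Finset.range (k + 1), B n x (u k) = 2 * α := fun k hk => by
    rw [Finset.sum_range_succ]
    linarith [(hu k hk).2.2]
  rcases lt_trichotomy j i with hji | rfl | hij
  · obtain ⟨k, rfl⟩ : ∃ k, i = k + 1 := ⟨i - 1, by omega⟩
    have hk : k < n := hin
    have huk : u k ∈ Set.Icc (0 : ℝ) 1 := ⟨(hu k hk).1.le, (hu k hk).2.1.le⟩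
    have hle : u k ≤ p := (not_le.1 (hmin k (Nat.lt_succ_self k))).le
    have ha := antitoneOn_sum_range_B n k huk ⟨h0, h1⟩ hle
    have hb := antitoneOn_sum_range_B n (k + 1) huk ⟨h0, h1⟩ hle
    have hc := hS (show j ≤ k by omega)
    have hd := hS (show k ≤ k + 1 by omega)
    have he := hmid k hk
    simp only at ha hb hc hd
    rw [abs_le]
    constructor <;>
      linarith [le_abs_self (1 - ∑ x ∈ Finset.range j, B n x p - (1 - α))]
  · exact le_rfl
  · have hi : i < n := by omega
    have hui : u i ∈ Set.Icc (0 : ℝ) 1 := ⟨(hu i hi).1.le, (hu i hi).2.1.le⟩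
    have ha := antitoneOn_sum_range_B n i ⟨h0, h1⟩ hui hmem
    have hb := antitoneOn_sum_range_B n (i + 1) ⟨h0, h1⟩ hui hmem
    have hc := hS (show i + 1 ≤ j by omega)
    have hd := hS (show i ≤ i + 1 by omega)
    have he := hmid i hi
    simp only at ha hb hc hd
    rw [abs_le]
    constructor <;>
      linarith [neg_abs_le (1 - ∑ x ∈ Finset.range j, B n x p - (1 - α))]

theorem stmt_8 (n : ℕ) (hn : 1 ≤ n)
    (α : ℝ) (hα1 : 0 < α) (hα2 : α < 1 / 2)
    (u : ℕ → ℝ) (hu : IsMidPUpper n α u)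
    (v : ℕ → ℝ) (hv0 : 0 ≤ v 0) (hvmono : ∀ i, i < n → v i ≤ v (i + 1))
    (hvn : v n = 1) :
    ((∫ p in (0:ℝ)..1, (cov n u p - (1 - α)) ^ 2)
        ≤ ∫ p in (0:ℝ)..1, (cov n v p - (1 - α)) ^ 2) ∧
      (∫ p in (0:ℝ)..1, |cov n u p - (1 - α)|)
        ≤ ∫ p in (0:ℝ)..1, |cov n v p - (1 - α)| := by
  constructor
  · refine intervalIntegral.integral_mono_on zero_le_one
      (intervalIntegrable_comp_cov n u (f := fun t => (t - (1 - α)) ^ 2) (by fun_prop))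
      (intervalIntegrable_comp_cov n v (f := fun t => (t - (1 - α)) ^ 2) (by fun_prop))
      fun p hp => ?_
    exact sq_le_sq.2 (abs_cov_midP_sub_le hu hvn hp.1 hp.2)
  · exact intervalIntegral.integral_mono_on zero_le_one
      (intervalIntegrable_comp_cov n u (f := fun t => |t - (1 - α)|) (by fun_prop))
      (intervalIntegrable_comp_cov n v (f := fun t => |t - (1 - α)|) (by fun_prop))
      fun p hp => abs_cov_midP_sub_le hu hvn hp.1 hp.2
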